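/- For every natural number n ≥ 1, G(0, 0, n) = 0 if and only if the 2-adic valuation ν₂(n) is even. -/

import Mathlib

namespace SharingNim

/-- The moves of three-pile Sharing Nim: take `k ≥ 1` tokens from one pile and add them to
another pile, provided the receiving pile has at most as many tokens as the source pile
after the move (i.e. `2 * k` is at most the difference of the two piles). -/
def moves : ℕ × ℕ × ℕ → Finset (ℕ × ℕ × ℕ)
  | (a, b, c) =>
    ((Finset.Icc 1 ((b - a) / 2)).image fun k => (a + k, b - k, c)) ∪
    ((Finset.Icc 1 ((a - b) / 2)).image fun k => (a - k, b + k, c)) ∪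
    ((Finset.Icc 1 ((c - a) / 2)).image fun k => (a + k, b, c - k)) ∪
    ((Finset.Icc 1 ((a - c) / 2)).image fun k => (a - k, b, c + k)) ∪
    ((Finset.Icc 1 ((c - b) / 2)).image fun k => (a, b + k, c - k)) ∪
    ((Finset.Icc 1 ((b - c) / 2)).image fun k => (a, b - k, c + k))

/-- The sum of squares of the pile sizes, a measure that strictly decreases along
every move. -/
def measure3 (p : ℕ × ℕ × ℕ) : ℕ := p.1 ^ 2 + p.2.1 ^ 2 + p.2.2 ^ 2

theorem sq_move_lt {x y k : ℕ} (hk : 1 ≤ k) (h : k ≤ (y - x) / 2) :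
    (x + k) ^ 2 + (y - k) ^ 2 < x ^ 2 + y ^ 2 := by
  have h1 : x + 2 * k ≤ y := by omega
  have h2 : k ≤ y := by omega
  zify [h2]
  nlinarith

theorem measure3_lt_of_mem_moves {q p : ℕ × ℕ × ℕ} (h : q ∈ moves p) :
    measure3 q < measure3 p := by
  obtain ⟨a, b, c⟩ := p
  simp only [moves, Finset.mem_union, Finset.mem_image, Finset.mem_Icc] at h
  rcases h with ((((⟨k, ⟨hk1, hk2⟩, rfl⟩ | ⟨k, ⟨hk1, hk2⟩, rfl⟩) | ⟨k, ⟨hk1, hk2⟩, rfl⟩) |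
      ⟨k, ⟨hk1, hk2⟩, rfl⟩) | ⟨k, ⟨hk1, hk2⟩, rfl⟩) | ⟨k, ⟨hk1, hk2⟩, rfl⟩ <;>
    simp only [measure3] <;>
    [linarith [sq_move_lt (x := a) (y := b) hk1 hk2];
     linarith [sq_move_lt (x := b) (y := a) hk1 hk2];
     linarith [sq_move_lt (x := a) (y := c) hk1 hk2];
     linarith [sq_move_lt (x := c) (y := a) hk1 hk2];
     linarith [sq_move_lt (x := b) (y := c) hk1 hk2];
     linarith [sq_move_lt (x := c) (y := b) hk1 hk2]]

/-- The minimum excludant of a finite set of naturals. -/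
noncomputable def mex (s : Finset ℕ) : ℕ := sInf {n : ℕ | n ∉ s}

/-- The Sprague–Grundy value of a position of three-pile Sharing Nim: the minimum
excludant of the Sprague–Grundy values of the positions reachable in one move. -/
noncomputable def G (p : ℕ × ℕ × ℕ) : ℕ :=
  mex ((moves p).attach.image fun q => G q.1)
termination_by measure3 p
decreasing_by exact measure3_lt_of_mem_moves q.2

/-- Even 2-adic valuation (true at `0`). -/
def EV (d : ℕ) : Prop := Even (padicValNat 2 d)

theorem EV_zero : EV 0 := by simp [EV]

theorem EV_odd {d : ℕ} (h : d % 2 = 1) : EV d := by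
  have : padicValNat 2 d = 0 := padicValNat.eq_zero_of_not_dvd (by omega)
  simp [EV, this]

theorem EV_two_mul {d : ℕ} (h : 0 < d) : EV (2 * d) ↔ ¬ EV d := by
  have : padicValNat 2 (2 * d) = padicValNat 2 d + 1 := by
    rw [padicValNat.mul (by norm_num) (by omega), padicValNat.self (by norm_num)]
    omega
  simp only [EV, this, Nat.even_add_one]

/-- Absolute difference. -/
def dd (a b : ℕ) : ℕ := (a - b) + (b - a)

theorem dd_comm (a b : ℕ) : dd a b = dd b a := by unfold dd; omega

/-- The claimed set of P-positions. -/
def PP (a b c : ℕ) : Prop :=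
  (a = b ∧ EV (dd a c)) ∨ (a = c ∧ EV (dd a b)) ∨ (b = c ∧ EV (dd a b))

theorem PP_swap12 {a b c : ℕ} (h : PP a b c) : PP b a c := by
  rcases h with ⟨rfl, h⟩ | ⟨rfl, h⟩ | ⟨rfl, h⟩
  · exact Or.inl ⟨rfl, h⟩
  · exact Or.inr (Or.inr ⟨rfl, by rwa [dd_comm]⟩)
  · exact Or.inr (Or.inl ⟨rfl, by rwa [dd_comm]⟩)

theorem PP_swap23 {a b c : ℕ} (h : PP a b c) : PP a c b := by
  rcases h with ⟨rfl, h⟩ | ⟨rfl, h⟩ | ⟨rfl, h⟩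
  · exact Or.inr (Or.inl ⟨rfl, h⟩)
  · exact Or.inl ⟨rfl, h⟩
  · exact Or.inr (Or.inr ⟨rfl, h⟩)

/-- Some move leads into the claimed set. -/
def TT (a b c : ℕ) : Prop := ∃ x y z, (x, y, z) ∈ moves (a, b, c) ∧ PP x y z

theorem mem_moves {a b c x y z : ℕ} : (x, y, z) ∈ moves (a, b, c) ↔
    ∃ k, 1 ≤ k ∧
      ((x = a + k ∧ b = y + k ∧ z = c ∧ x ≤ y) ∨ (a = x + k ∧ y = b + k ∧ z = c ∧ y ≤ x) ∨
       (x = a + k ∧ c = z + k ∧ y = b ∧ x ≤ z) ∨ (a = x + k ∧ z = c + k ∧ y = b ∧ z ≤ x) ∨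
       (y = b + k ∧ c = z + k ∧ x = a ∧ y ≤ z) ∨ (b = y + k ∧ z = c + k ∧ x = a ∧ z ≤ y)) := by
  simp only [moves, Finset.mem_union, Finset.mem_image, Finset.mem_Icc, Prod.mk.injEq]
  constructor
  · rintro (((((⟨k, h⟩ | ⟨k, h⟩) | ⟨k, h⟩) | ⟨k, h⟩) | ⟨k, h⟩) | ⟨k, h⟩)
    · exact ⟨k, by omega, Or.inl (by omega)⟩
    · exact ⟨k, by omega, Or.inr (Or.inl (by omega))⟩
    · exact ⟨k, by omega, Or.inr (Or.inr (Or.inl (by omega)))⟩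
    · exact ⟨k, by omega, Or.inr (Or.inr (Or.inr (Or.inl (by omega))))⟩
    · exact ⟨k, by omega, Or.inr (Or.inr (Or.inr (Or.inr (Or.inl (by omega)))))⟩
    · exact ⟨k, by omega, Or.inr (Or.inr (Or.inr (Or.inr (Or.inr (by omega)))))⟩
  · rintro ⟨k, hk, h | h | h | h | h | h⟩
    · exact Or.inl (Or.inl (Or.inl (Or.inl (Or.inl ⟨k, by omega⟩))))
    · exact Or.inl (Or.inl (Or.inl (Or.inl (Or.inr ⟨k, by omega⟩))))
    · exact Or.inl (Or.inl (Or.inl (Or.inr ⟨k, by omega⟩)))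
    · exact Or.inl (Or.inl (Or.inr ⟨k, by omega⟩))
    · exact Or.inl (Or.inr ⟨k, by omega⟩)
    · exact Or.inr ⟨k, by omega⟩

theorem TT_swap12 {a b c : ℕ} (h : TT a b c) : TT b a c := by
  obtain ⟨x, y, z, h, hp⟩ := h
  refine ⟨y, x, z, ?_, PP_swap12 hp⟩
  rw [mem_moves] at h ⊢
  obtain ⟨k, hk, h | h | h | h | h | h⟩ := h
  · exact ⟨k, hk, Or.inr (Or.inl (by omega))⟩
  · exact ⟨k, hk, Or.inl (by omega)⟩
  · exact ⟨k, hk, Or.inr (Or.inr (Or.inr (Or.inr (Or.inl (by omega)))))⟩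
  · exact ⟨k, hk, Or.inr (Or.inr (Or.inr (Or.inr (Or.inr (by omega)))))⟩
  · exact ⟨k, hk, Or.inr (Or.inr (Or.inl (by omega)))⟩
  · exact ⟨k, hk, Or.inr (Or.inr (Or.inr (Or.inl (by omega))))⟩

theorem TT_swap23 {a b c : ℕ} (h : TT a b c) : TT a c b := by
  obtain ⟨x, y, z, h, hp⟩ := h
  refine ⟨x, z, y, ?_, PP_swap23 hp⟩
  rw [mem_moves] at h ⊢
  obtain ⟨k, hk, h | h | h | h | h | h⟩ := h
  · exact ⟨k, hk, Or.inr (Or.inr (Or.inl (by omega)))⟩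
  · exact ⟨k, hk, Or.inr (Or.inr (Or.inr (Or.inl (by omega))))⟩
  · exact ⟨k, hk, Or.inl (by omega)⟩
  · exact ⟨k, hk, Or.inr (Or.inl (by omega))⟩
  · exact ⟨k, hk, Or.inr (Or.inr (Or.inr (Or.inr (Or.inr (by omega)))))⟩
  · exact ⟨k, hk, Or.inr (Or.inr (Or.inr (Or.inr (Or.inl (by omega)))))⟩

/-- No move stays inside the claimed set, equal pair in the first two coordinates. -/
theorem not_TT_aux {a c : ℕ} (h : EV (dd a c)) : ¬ TT a a c := by
  rintro ⟨x, y, z, hm, hp⟩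
  rw [mem_moves] at hm
  obtain ⟨k, hk, hm⟩ := hm
  have key : ∀ d, 0 < d → EV d → dd a c = 2 * d → False := by
    intro d hd h1 h2
    rw [h2, EV_two_mul hd] at h
    exact h h1
  rcases hm with hm | hm | hm | hm | hm | hm <;>
  rcases hp with ⟨e, h1⟩ | ⟨e, h1⟩ | ⟨e, h1⟩ <;>
    exact key _ (by unfold dd; omega) h1 (by unfold dd; omega)

theorem not_TT {a b c : ℕ} (h : PP a b c) : ¬ TT a b c := by
  rcases h with ⟨rfl, h⟩ | ⟨rfl, h⟩ | ⟨rfl, h⟩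
  · exact not_TT_aux h
  · exact fun ht => not_TT_aux h (TT_swap23 ht)
  · rw [dd_comm] at h
    exact fun ht => not_TT_aux h (TT_swap23 (TT_swap12 ht))

theorem EV_or (d : ℕ) : EV d ∨ ∃ e, 0 < e ∧ d = 2 * e ∧ EV e := by
  by_cases h : EV d
  · exact Or.inl h
  · right
    have h2 : d % 2 = 0 := by
      by_contra h3
      exact h (EV_odd (by omega))
    have h0 : d ≠ 0 := by
      rintro rfl
      exact h EV_zero
    refine ⟨d / 2, by omega, by omega, ?_⟩
    by_contra h3
    rw [← EV_two_mul (by omega), show 2 * (d / 2) = d by omega] at h3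
    exact h h3

theorem TT_sorted {a b c : ℕ} (hab : a ≤ b) (hbc : b ≤ c) (h : ¬ PP a b c) : TT a b c := by
  rcases EV_or (dd (b - a) (c - b)) with hE | ⟨e, he, hd, hE⟩
  · by_cases h1 : a = b
    · refine absurd (Or.inl ⟨h1, ?_⟩) h
      convert hE using 1
      unfold dd; omega
    by_cases h2 : b = c
    · refine absurd (Or.inr (Or.inr ⟨h2, ?_⟩)) h
      convert hE using 1
      unfold dd; omega
    rcases le_total (b - a) (c - b) with h3 | h3
    · refine ⟨b, b, c - (b - a), mem_moves.2 ⟨b - a, by omega, Or.inr (Or.inr (Or.inl (by omega)))⟩, Or.inl ⟨rfl, ?_⟩⟩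
      convert hE using 1
      unfold dd; omega
    · refine ⟨a + (c - b), b, b, mem_moves.2 ⟨c - b, by omega, Or.inr (Or.inr (Or.inl (by omega)))⟩,
        Or.inr (Or.inr ⟨rfl, ?_⟩)⟩
      convert hE using 1
      unfold dd; omega
  · unfold dd at hd
    refine ⟨a + (c - a) / 2, b, a + (c - a) / 2,
      mem_moves.2 ⟨(c - a) / 2, by omega, Or.inr (Or.inr (Or.inl (by omega)))⟩, Or.inr (Or.inl ⟨rfl, ?_⟩)⟩
    convert hE using 1
    unfold dd; omega

theorem TT_of_not {a b c : ℕ} (h : ¬ PP a b c) : TT a b c := by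
  rcases le_total a b with h1 | h1 <;> rcases le_total b c with h2 | h2 <;>
    rcases le_total a c with h3 | h3
  · exact TT_sorted h1 h2 h
  · exact TT_sorted h1 h2 h
  · exact TT_swap23 (TT_sorted h3 h2 fun hp => h (PP_swap23 hp))
  · exact TT_swap23 (TT_swap12 (TT_sorted h3 h1 fun hp => h (PP_swap23 (PP_swap12 hp))))
  · exact TT_swap12 (TT_sorted h1 h3 fun hp => h (PP_swap12 hp))
  · exact TT_swap12 (TT_swap23 (TT_sorted h2 h3 fun hp => h (PP_swap12 (PP_swap23 hp))))
  · exact TT_swap12 (TT_swap23 (TT_swap12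
      (TT_sorted h2 h1 fun hp => h (PP_swap12 (PP_swap23 (PP_swap12 hp))))))
  · exact TT_swap12 (TT_swap23 (TT_swap12
      (TT_sorted h2 h1 fun hp => h (PP_swap12 (PP_swap23 (PP_swap12 hp))))))

theorem mex_eq_zero {s : Finset ℕ} : mex s = 0 ↔ 0 ∉ s := by
  unfold mex
  rw [Nat.sInf_eq_zero]
  constructor
  · rintro (h | h)
    · exact h
    · obtain ⟨n, hn⟩ := Infinite.exists_notMem_finset s
      have : n ∈ {n : ℕ | n ∉ s} := hn
      rw [h] at this
      exact this.elim
  · exact fun h => Or.inl h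

theorem G_eq_zero {p : ℕ × ℕ × ℕ} : G p = 0 ↔ ∀ q ∈ moves p, G q ≠ 0 := by
  rw [G, mex_eq_zero]
  simp

theorem G_iff (m : ℕ) : ∀ a b c, measure3 (a, b, c) = m → (G (a, b, c) = 0 ↔ PP a b c) := by
  induction m using Nat.strong_induction_on with
  | _ m ih =>
    rintro a b c rfl
    rw [G_eq_zero]
    constructor
    · intro h
      by_contra hp
      obtain ⟨x, y, z, hm, hq⟩ := TT_of_not hp
      exact h _ hm ((ih _ (measure3_lt_of_mem_moves hm) x y z rfl).2 hq)
    · rintro hp ⟨x, y, z⟩ hm h0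
      exact not_TT hp ⟨x, y, z, hm, (ih _ (measure3_lt_of_mem_moves hm) x y z rfl).1 h0⟩

/-- For `n ≥ 1`, `(0,0,n)` is a P-position iff `ν₂(n)` is even. -/
theorem grundy_zero_iff_even_padicValNat (n : ℕ) (hn : 1 ≤ n) :
    G (0, 0, n) = 0 ↔ Even (padicValNat 2 n) := by
  rw [G_iff _ 0 0 n rfl]
  constructor
  · rintro (⟨-, h⟩ | ⟨h, -⟩ | ⟨h, -⟩)
    · simpa [dd, EV] using h
    · omega
    · omega
  · intro h
    exact Or.inl ⟨rfl, by simpa [dd, EV] using h⟩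

end SharingNim
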